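/- For every real ε with 0 < ε < 1/4, one has (1/√2)·∫₀^{2π} max(0, −√(2ε) − √(1 − 2ε)·cos α) dα = −2√ε·arccos √(ε/(1/2 − ε)) + 2·√(1/2 − 2ε). -/

import Mathlib

open MeasureTheory Real

theorem stmt_8 (ε : ℝ) (h1 : 0 < ε) (h2 : ε < 1/4) :
    (1/Real.sqrt 2) * ∫ α in (0:ℝ)..(2*Real.pi),
        max 0 (-Real.sqrt (2*ε) - Real.sqrt (1 - 2*ε) * Real.cos α) =
      -(2 * Real.sqrt ε * Real.arccos (Real.sqrt (ε/(1/2 - ε))))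
        + 2 * Real.sqrt (1/2 - 2*ε) := by
  have hb : 0 < Real.sqrt (1 - 2*ε) := Real.sqrt_pos.2 (by linarith)
  have hbc : Real.sqrt (1 - 2*ε) * Real.sqrt (ε/(1/2 - ε)) = Real.sqrt (2*ε) := by
    rw [← Real.sqrt_mul (by linarith)]
    congr 1
    have h3 : (1/2 - ε) * (ε/(1/2 - ε)) = ε := by
      rw [mul_comm]; exact div_mul_cancel₀ _ (by linarith)
    linear_combination 2 * h3
  have hc0 : 0 ≤ Real.sqrt (ε/(1/2 - ε)) := Real.sqrt_nonneg _
  have hc1 : Real.sqrt (ε/(1/2 - ε)) ≤ 1 := by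
    rw [Real.sqrt_le_iff, one_pow]
    refine ⟨zero_le_one, ?_⟩
    rw [div_le_one (by linarith)]
    linarith
  have hcos := Real.cos_arccos (by linarith : -1 ≤ Real.sqrt (ε/(1/2 - ε))) hc1
  have hsin := Real.sin_arccos (Real.sqrt (ε/(1/2 - ε)))
  rw [Real.sq_sqrt (div_nonneg h1.le (by linarith))] at hsin
  have hbs : Real.sqrt (1 - 2*ε) * Real.sin (Real.arccos (Real.sqrt (ε/(1/2 - ε))))
      = Real.sqrt (1 - 4*ε) := by
    rw [hsin, ← Real.sqrt_mul (by linarith)]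
    congr 1
    have h3 : (1/2 - ε) * (ε/(1/2 - ε)) = ε := by
      rw [mul_comm]; exact div_mul_cancel₀ _ (by linarith)
    linear_combination (-2) * h3
  have ht0 := Real.arccos_nonneg (Real.sqrt (ε/(1/2 - ε)))
  have htp := Real.arccos_le_pi (Real.sqrt (ε/(1/2 - ε)))
  have e1 : Real.sqrt (2*ε) = Real.sqrt 2 * Real.sqrt ε := Real.sqrt_mul (by norm_num) _
  have e2 : Real.sqrt (1 - 4*ε) = Real.sqrt 2 * Real.sqrt (1/2 - 2*ε) := by
    rw [← Real.sqrt_mul (by norm_num)]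
    congr 1
    ring
  have hs2 : 0 < Real.sqrt 2 := by positivity
  generalize Real.arccos (Real.sqrt (ε/(1/2 - ε))) = θ at *
  generalize Real.sqrt (ε/(1/2 - ε)) = c at *
  generalize Real.sqrt (1 - 2*ε) = b at *
  have habs : ∀ α : ℝ, Real.cos α = - Real.cos |α - Real.pi| := by
    intro α
    rw [Real.cos_abs, Real.cos_sub_pi, neg_neg]
  have hout : ∀ α : ℝ, |α - Real.pi| ≤ Real.pi → θ ≤ |α - Real.pi| →
      max 0 (-Real.sqrt (2*ε) - b * Real.cos α) = 0 := by
    intro α h h'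
    apply max_eq_left
    have := Real.cos_le_cos_of_nonneg_of_le_pi ht0 h h'
    rw [habs, ← hbc]
    nlinarith
  have hin : ∀ α : ℝ, |α - Real.pi| ≤ θ →
      max 0 (-Real.sqrt (2*ε) - b * Real.cos α) = -Real.sqrt (2*ε) - b * Real.cos α := by
    intro α h
    apply max_eq_right
    have := Real.cos_le_cos_of_nonneg_of_le_pi (abs_nonneg _) htp h
    rw [habs, ← hbc]
    nlinarith
  have hint : ∀ x y : ℝ, IntervalIntegrable
      (fun α => max 0 (-Real.sqrt (2*ε) - b * Real.cos α)) volume x y := by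
    intro x y
    apply Continuous.intervalIntegrable
    fun_prop
  have I1 : ∫ α in (0:ℝ)..(Real.pi - θ), max 0 (-Real.sqrt (2*ε) - b * Real.cos α) = 0 := by
    rw [intervalIntegral.integral_congr (g := fun _ => (0:ℝ))]
    · simp
    · intro α hα
      rw [Set.uIcc_of_le (by linarith)] at hα
      have h0 : |α - Real.pi| = Real.pi - α := by
        rw [abs_of_nonpos (by linarith [hα.2])]; ring
      exact hout α (by linarith [hα.1]) (by linarith [hα.2])
  have I3 : ∫ α in (Real.pi + θ)..(2 * Real.pi),
      max 0 (-Real.sqrt (2*ε) - b * Real.cos α) = 0 := by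
    rw [intervalIntegral.integral_congr (g := fun _ => (0:ℝ))]
    · simp
    · intro α hα
      rw [Set.uIcc_of_le (by linarith)] at hα
      have h0 : |α - Real.pi| = α - Real.pi := abs_of_nonneg (by linarith [hα.1])
      exact hout α (by linarith [hα.2]) (by linarith [hα.1])
  have I2 : ∫ α in (Real.pi - θ)..(Real.pi + θ),
      max 0 (-Real.sqrt (2*ε) - b * Real.cos α)
      = -(2 * θ * Real.sqrt (2*ε)) + 2 * (b * Real.sin θ) := by
    rw [intervalIntegral.integral_congr (g := fun α => -Real.sqrt (2*ε) - b * Real.cos α)]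
    · rw [intervalIntegral.integral_sub (by simp)
        (by apply Continuous.intervalIntegrable; fun_prop),
        intervalIntegral.integral_const_mul, integral_cos, intervalIntegral.integral_const,
        Real.sin_pi_sub, Real.sin_add, Real.sin_pi, Real.cos_pi, smul_eq_mul]
      ring
    · intro α hα
      rw [Set.uIcc_of_le (by linarith)] at hα
      exact hin α (abs_le.2 ⟨by linarith [hα.1], by linarith [hα.2]⟩)
  rw [← intervalIntegral.integral_add_adjacent_intervals (hint 0 (Real.pi - θ)) (hint _ _),
    ← intervalIntegral.integral_add_adjacent_intervals
      (hint (Real.pi - θ) (Real.pi + θ)) (hint _ _), I1, I2, I3, hbs, e1, e2]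
  field_simp
  ring
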